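/- Stability of viscosity solutions under uniform convergence (Proposition 2.10). For each n ∈ ℕ let H_n = (H_n^j) be a Hamiltonian on Γ satisfying (H0)–(H6), and let H = (H^j) be a Hamiltonian on Γ satisfying (H0)–(H6). Let u_n be a viscosity solution of H_n(x, u_n, ∂u_n) = 0 on Γ for each n. Assume that, as n → ∞, H_n^j(x,r,p) → H^j(x,r,p) locally uniformly on [0,l_j]×ℝ×ℝ for every j ∈ J, and u_n → u uniformly on Γ. Then u is a viscosity solution of H(x,u,∂u) = 0 on Γ. -/

import Mathlib

open Set

noncomputable section

/-- A finite connected topological network. -/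
structure Network where
  I : Type
  J : Type
  finI : Fintype I
  finJ : Fintype J
  neI : Nonempty I
  neJ : Nonempty J
  l : J → ℝ
  l_pos : ∀ j, 0 < l j
  s : J → I
  t : J → I
  st_ne : ∀ j, s j ≠ t j
  conn : ∀ i i' : I,
    Relation.ReflTransGen (fun a b => ∃ j, (s j = a ∧ t j = b) ∨ (s j = b ∧ t j = a)) i i'
  IB : Set I
  IB_ne : IB.Nonempty
  deg_one_bd : ∀ i : I, ({j : J | s j = i ∨ t j = i} : Set J).ncard = 1 → i ∈ IB

attribute [instance] Network.finI Network.finJ Network.neI Network.neJ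

namespace Network

open scoped Classical

variable (N : Network)

/-- The set of edges incident to the vertex `i`. -/
def Inc (i : N.I) : Set N.J := {j | N.s j = i ∨ N.t j = i}

/-- The set of transition vertices. -/
def IT : Set N.I := N.IBᶜ

/-- The signed incidence `a_{ij}`. -/
def sgn (i : N.I) (j : N.J) : ℝ := if N.s j = i then 1 else -1

/-- The parameter `y_i^j` of the vertex `i` on the edge `j`. -/
def param (i : N.I) (j : N.J) : ℝ := if N.s j = i then 0 else N.l j

/-- The edge `j` as a parameter interval. -/
def edge (j : N.J) : Set ℝ := Icc 0 (N.l j)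

/-- A family `(u^j)` of functions on the edges defines a function on the network iff
the values at each vertex agree. -/
def Compat (u : N.J → ℝ → ℝ) : Prop :=
  ∀ i : N.I, ∀ j ∈ N.Inc i, ∀ k ∈ N.Inc i, u j (N.param i j) = u k (N.param i k)

/-- `u ∈ C(Γ)`. -/
def IsCont (u : N.J → ℝ → ℝ) : Prop :=
  N.Compat u ∧ ∀ j, ContinuousOn (u j) (N.edge j)

/-- `u ∈ C²(Γ)`. -/
def IsC2 (u : N.J → ℝ → ℝ) : Prop :=
  N.Compat u ∧ ∀ j, ContDiffOn ℝ 2 (u j) (N.edge j)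

/-- First derivative `∂_j u` along the edge `j`. -/
def pd (u : N.J → ℝ → ℝ) (j : N.J) (x : ℝ) : ℝ := derivWithin (u j) (N.edge j) x

/-- Second derivative `∂²_j u` along the edge `j`. -/
def pd2 (u : N.J → ℝ → ℝ) (j : N.J) (x : ℝ) : ℝ := derivWithin (N.pd u j) (N.edge j) x

/-- Sum over the edges incident to `i`. -/
def incSum (i : N.I) (f : N.J → ℝ) : ℝ := ∑ j : N.J, if j ∈ N.Inc i then f j else 0

/-- The Kirchhoff sum `S^i_β u`. -/
def kir (β : N.I → N.J → ℝ) (u : N.J → ℝ → ℝ) (i : N.I) : ℝ :=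
  N.incSum i (fun j => β i j * N.sgn i j * N.pd u j (N.param i j))

/-- `u ∈ C²_{*,β}(Γ)`. -/
def IsC2Star (β : N.I → N.J → ℝ) (u : N.J → ℝ → ℝ) : Prop :=
  N.IsC2 u ∧ ∀ i ∈ N.IT, N.kir β u i = 0

/-- (H0): continuity of each `H^j`. -/
def H0 (H : N.J → ℝ → ℝ → ℝ → ℝ) : Prop :=
  ∀ j, ContinuousOn (fun q : ℝ × ℝ × ℝ => H j q.1 q.2.1 q.2.2)
    ((N.edge j) ×ˢ (univ : Set ℝ) ×ˢ (univ : Set ℝ))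

/-- (H1): `r ↦ H^j(x,r,p)` is nondecreasing. -/
def H1 (H : N.J → ℝ → ℝ → ℝ → ℝ) : Prop :=
  ∀ j, ∀ x ∈ N.edge j, ∀ p : ℝ, Monotone fun r => H j x r p

/-- (H3): `p ↦ H^j(v_i,r,p)` is nondecreasing on `(0,∞)` at transition vertices. -/
def H3 (H : N.J → ℝ → ℝ → ℝ → ℝ) : Prop :=
  ∀ i ∈ N.IT, ∀ j ∈ N.Inc i, ∀ r : ℝ,
    MonotoneOn (fun p => H j (N.param i j) r p) (Ioi (0 : ℝ))

/-- (H4): coercivity in `p`, uniform on bounded `r`-sets. -/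
def H4 (H : N.J → ℝ → ℝ → ℝ → ℝ) : Prop :=
  ∀ j, ∀ R : ℝ, 0 < R → ∀ A : ℝ, ∃ M : ℝ, ∀ x ∈ N.edge j, ∀ r : ℝ, |r| ≤ R →
    ∀ p : ℝ, M < |p| → A < H j x r p

/-- (H5): continuity of `H` at the transition vertices. -/
def H5 (H : N.J → ℝ → ℝ → ℝ → ℝ) : Prop :=
  ∀ i ∈ N.IT, ∀ j ∈ N.Inc i, ∀ k ∈ N.Inc i, ∀ r p : ℝ,
    H j (N.param i j) r p = H k (N.param i k) r p

/-- (H6): symmetry of `H` in `p` at the transition vertices. -/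
def H6 (H : N.J → ℝ → ℝ → ℝ → ℝ) : Prop :=
  ∀ i ∈ N.IT, ∀ j ∈ N.Inc i, ∀ r p : ℝ,
    H j (N.param i j) r p = H j (N.param i j) r (-p)

end Network

namespace Network

variable (N : Network)

/-- `u ∈ USC(Γ)`. -/
def IsUSC (u : N.J → ℝ → ℝ) : Prop :=
  N.Compat u ∧ ∀ j, UpperSemicontinuousOn (u j) (N.edge j)

/-- `u ∈ LSC(Γ)`. -/
def IsLSC (u : N.J → ℝ → ℝ) : Prop :=
  N.Compat u ∧ ∀ j, LowerSemicontinuousOn (u j) (N.edge j)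

/-- `φ` is a `(j,k)`-test function at the transition vertex `i`. -/
def IsTestJK (φ : N.J → ℝ → ℝ) (i : N.I) (j k : N.J) : Prop :=
  N.IsCont φ ∧
  DifferentiableWithinAt ℝ (φ j) (N.edge j) (N.param i j) ∧
  DifferentiableWithinAt ℝ (φ k) (N.edge k) (N.param i k) ∧
  N.sgn i j * N.pd φ j (N.param i j) + N.sgn i k * N.pd φ k (N.param i k) = 0

/-- `w` has a local maximum at the vertex `i` relative to `ē_j ∪ ē_k`. -/
def LocalMaxVertex (w : N.J → ℝ → ℝ) (i : N.I) (j k : N.J) : Prop :=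
  ∃ δ > 0, (∀ x ∈ N.edge j, |x - N.param i j| < δ → w j x ≤ w j (N.param i j)) ∧
           (∀ x ∈ N.edge k, |x - N.param i k| < δ → w k x ≤ w k (N.param i k))

/-- `w` has a local minimum at the vertex `i` relative to `ē_j ∪ ē_k`. -/
def LocalMinVertex (w : N.J → ℝ → ℝ) (i : N.I) (j k : N.J) : Prop :=
  ∃ δ > 0, (∀ x ∈ N.edge j, |x - N.param i j| < δ → w j (N.param i j) ≤ w j x) ∧
           (∀ x ∈ N.edge k, |x - N.param i k| < δ → w k (N.param i k) ≤ w k x)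

/-- `u` is a viscosity subsolution of `H(x,u,∂u) = 0` on `Γ`. -/
def IsSubsol (H : N.J → ℝ → ℝ → ℝ → ℝ) (u : N.J → ℝ → ℝ) : Prop :=
  N.IsUSC u ∧
  (∀ j : N.J, ∀ y ∈ Ioo 0 (N.l j), ∀ φ : N.J → ℝ → ℝ, N.IsCont φ →
    DifferentiableWithinAt ℝ (φ j) (N.edge j) y →
    (∃ δ > 0, ∀ x ∈ N.edge j, |x - y| < δ → u j x - φ j x ≤ u j y - φ j y) →
    H j y (u j y) (N.pd φ j y) ≤ 0) ∧
  (∀ i ∈ N.IT, ∀ j ∈ N.Inc i, ∀ k ∈ N.Inc i, j ≠ k →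
    ∀ φ : N.J → ℝ → ℝ, N.IsTestJK φ i j k →
    N.LocalMaxVertex (fun m x => u m x - φ m x) i j k →
    H j (N.param i j) (u j (N.param i j)) (N.pd φ j (N.param i j)) ≤ 0)

/-- `u` is a viscosity supersolution of `H(x,u,∂u) = 0` on `Γ`. -/
def IsSupersol (H : N.J → ℝ → ℝ → ℝ → ℝ) (u : N.J → ℝ → ℝ) : Prop :=
  N.IsLSC u ∧
  (∀ j : N.J, ∀ y ∈ Ioo 0 (N.l j), ∀ φ : N.J → ℝ → ℝ, N.IsCont φ →
    DifferentiableWithinAt ℝ (φ j) (N.edge j) y →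
    (∃ δ > 0, ∀ x ∈ N.edge j, |x - y| < δ → u j y - φ j y ≤ u j x - φ j x) →
    0 ≤ H j y (u j y) (N.pd φ j y)) ∧
  (∀ i ∈ N.IT, ∀ j ∈ N.Inc i, ∃ k ∈ N.Inc i, k ≠ j ∧
    ∀ φ : N.J → ℝ → ℝ, N.IsTestJK φ i j k →
    N.LocalMinVertex (fun m x => u m x - φ m x) i j k →
    0 ≤ H j (N.param i j) (u j (N.param i j)) (N.pd φ j (N.param i j)))

/-- `u` is a viscosity solution of `H(x,u,∂u) = 0` on `Γ`. -/
def IsViscSol (H : N.J → ℝ → ℝ → ℝ → ℝ) (u : N.J → ℝ → ℝ) : Prop :=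
  N.IsCont u ∧ N.IsSubsol H u ∧ N.IsSupersol H u

end Network

namespace Network

open Filter Topology

/-- A quadratic with slope `p` at `y`, cut off outside `|x - y| < 2 * δ`. -/
def cutoffQuadratic (p c δ y x : ℝ) : ℝ :=
  (p * (x - y) + c * (x - y) ^ 2) * max 0 (min 1 (2 - |x - y| / δ))

lemma cutoffQuadratic_of_abs_le {p c δ y x : ℝ} (hδ : 0 < δ) (hx : |x - y| ≤ δ) :
    cutoffQuadratic p c δ y x = p * (x - y) + c * (x - y) ^ 2 := by
  have h : |x - y| / δ ≤ 1 := (div_le_one hδ).2 hx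
  rw [cutoffQuadratic, min_eq_left (by linarith), max_eq_right zero_le_one, mul_one]

lemma cutoffQuadratic_of_le_abs {p c δ y x : ℝ} (hδ : 0 < δ) (hx : 2 * δ ≤ |x - y|) :
    cutoffQuadratic p c δ y x = 0 := by
  have h : 2 ≤ |x - y| / δ := (le_div_iff₀ hδ).2 hx
  rw [cutoffQuadratic, max_eq_left ((min_le_right _ _).trans (by linarith)), mul_zero]

@[simp] lemma cutoffQuadratic_self (p c δ y : ℝ) : cutoffQuadratic p c δ y y = 0 := by
  simp [cutoffQuadratic]

lemma continuous_cutoffQuadratic (p c δ y : ℝ) : Continuous (cutoffQuadratic p c δ y) := by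
  unfold cutoffQuadratic
  fun_prop

lemma hasDerivAt_cutoffQuadratic {p c δ y x : ℝ} (hδ : 0 < δ) (hx : |x - y| < δ) :
    HasDerivAt (cutoffQuadratic p c δ y) (p + 2 * c * (x - y)) x := by
  have h1 : HasDerivAt (fun z => p * (z - y) + c * (z - y) ^ 2) (p + 2 * c * (x - y)) x := by
    have h := (hasDerivAt_id x).sub_const y
    refine ((h.const_mul p).add ((h.pow 2).const_mul c)).congr_deriv ?_
    simp only [id_eq]
    ring
  refine h1.congr_of_eventuallyEq ?_
  have hc : ContinuousAt (fun z => |z - y|) x := by fun_prop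
  filter_upwards [hc.eventually_lt_const hx] with z hz
  exact cutoffQuadratic_of_abs_le hδ hz.le

lemma hasDerivAt_cutoffQuadratic_self {p c δ y : ℝ} (hδ : 0 < δ) :
    HasDerivAt (cutoffQuadratic p c δ y) p y := by
  simpa using hasDerivAt_cutoffQuadratic (p := p) (c := c) (x := y) (y := y) hδ (by simpa)

variable (N : Network)

lemma param_eq_zero_or (i : N.I) (j : N.J) : N.param i j = 0 ∨ N.param i j = N.l j := by
  unfold param
  split_ifs <;> simp

lemma param_mem_edge (i : N.I) (j : N.J) : N.param i j ∈ N.edge j := by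
  have := N.l_pos j
  rcases N.param_eq_zero_or i j with h | h <;> rw [h, edge] <;> constructor <;> linarith

lemma abs_sgn (i : N.I) (j : N.J) : |N.sgn i j| = 1 := by
  unfold sgn
  split_ifs <;> simp

lemma uniqueDiffWithinAt_edge {j : N.J} {x : ℝ} (hx : x ∈ N.edge j) :
    UniqueDiffWithinAt ℝ (N.edge j) x :=
  uniqueDiffOn_Icc (N.l_pos j) x hx

/-- Two continuous functions on edges which vanish at all endpoints extend to the network. -/
lemma exists_isCont_extension (j k : N.J) {f g : ℝ → ℝ} (hf : Continuous f) (hg : Continuous g)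
    (hf0 : f 0 = 0) (hfl : f (N.l j) = 0) (hg0 : g 0 = 0) (hgl : g (N.l k) = 0) :
    ∃ φ : N.J → ℝ → ℝ, N.IsCont φ ∧ φ j = f ∧ (j ≠ k → φ k = g) := by
  classical
  let φ : N.J → ℝ → ℝ := fun m => if m = j then f else if m = k then g else 0
  have hφ : ∀ m, Continuous (φ m) ∧ φ m 0 = 0 ∧ φ m (N.l m) = 0 := by
    intro m
    by_cases hj : m = j
    · subst hj
      simp [φ, hf, hf0, hfl]
    · by_cases hk : m = k
      · subst hk
        simp [φ, hj, hg, hg0, hgl]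
      · simp only [φ, hj, hk, if_false]
        exact ⟨continuous_zero, rfl, rfl⟩
  have hv : ∀ i m, φ m (N.param i m) = 0 := by
    intro i m
    rcases N.param_eq_zero_or i m with h | h <;> rw [h]
    exacts [(hφ m).2.1, (hφ m).2.2]
  refine ⟨φ, ⟨fun i m _ m' _ => by rw [hv, hv], fun m => (hφ m).1.continuousOn⟩, by simp [φ], ?_⟩
  intro hjk
  simp [φ, hjk.symm]

/-- The subsolution condition in the interior of the edge `j`. -/
def EdgeSub (H : N.J → ℝ → ℝ → ℝ → ℝ) (u : N.J → ℝ → ℝ) (j : N.J) : Prop :=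
  ∀ y ∈ Ioo 0 (N.l j), ∀ φ : N.J → ℝ → ℝ, N.IsCont φ →
    DifferentiableWithinAt ℝ (φ j) (N.edge j) y →
    (∃ δ > 0, ∀ x ∈ N.edge j, |x - y| < δ → u j x - φ j x ≤ u j y - φ j y) →
    H j y (u j y) (N.pd φ j y) ≤ 0

/-- The subsolution condition at the vertex `i` relative to the edges `j` and `k`. -/
def VertexSub (H : N.J → ℝ → ℝ → ℝ → ℝ) (u : N.J → ℝ → ℝ) (i : N.I) (j k : N.J) : Prop :=
  ∀ φ : N.J → ℝ → ℝ, N.IsTestJK φ i j k →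
    N.LocalMaxVertex (fun m x => u m x - φ m x) i j k →
    H j (N.param i j) (u j (N.param i j)) (N.pd φ j (N.param i j)) ≤ 0

/-- The supersolution condition in the interior of the edge `j`. -/
def EdgeSuper (H : N.J → ℝ → ℝ → ℝ → ℝ) (u : N.J → ℝ → ℝ) (j : N.J) : Prop :=
  ∀ y ∈ Ioo 0 (N.l j), ∀ φ : N.J → ℝ → ℝ, N.IsCont φ →
    DifferentiableWithinAt ℝ (φ j) (N.edge j) y →
    (∃ δ > 0, ∀ x ∈ N.edge j, |x - y| < δ → u j y - φ j y ≤ u j x - φ j x) →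
    0 ≤ H j y (u j y) (N.pd φ j y)

/-- The supersolution condition at the vertex `i` relative to the edges `j` and `k`. -/
def VertexSuper (H : N.J → ℝ → ℝ → ℝ → ℝ) (u : N.J → ℝ → ℝ) (i : N.I) (j k : N.J) : Prop :=
  ∀ φ : N.J → ℝ → ℝ, N.IsTestJK φ i j k →
    N.LocalMinVertex (fun m x => u m x - φ m x) i j k →
    0 ≤ H j (N.param i j) (u j (N.param i j)) (N.pd φ j (N.param i j))

/-- The Hamiltonian satisfied by `-u` when `u` satisfies the one of `H`. -/
def dual {J : Type} (H : J → ℝ → ℝ → ℝ → ℝ) : J → ℝ → ℝ → ℝ → ℝ :=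
  fun j x r p => -H j x (-r) (-p)

lemma dual_dual {J : Type} (H : J → ℝ → ℝ → ℝ → ℝ) : dual (dual H) = H := by
  funext j x r p
  simp [dual]

variable {N}

lemma IsCont.neg {φ : N.J → ℝ → ℝ} (h : N.IsCont φ) : N.IsCont (-φ) :=
  ⟨fun i j hj k hk => congrArg Neg.neg (h.1 i j hj k hk), fun j => (h.2 j).neg⟩

lemma pd_neg (φ : N.J → ℝ → ℝ) (j : N.J) (x : ℝ) : N.pd (-φ) j x = -N.pd φ j x :=
  derivWithin.neg

lemma IsTestJK.neg {φ : N.J → ℝ → ℝ} {i : N.I} {j k : N.J} (h : N.IsTestJK φ i j k) :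
    N.IsTestJK (-φ) i j k := by
  refine ⟨h.1.neg, h.2.1.neg, h.2.2.1.neg, ?_⟩
  rw [pd_neg, pd_neg]
  linarith [h.2.2.2]

lemma EdgeSuper.edgeSub_dual {H : N.J → ℝ → ℝ → ℝ → ℝ} {u : N.J → ℝ → ℝ} {j : N.J}
    (h : N.EdgeSuper H u j) : N.EdgeSub (dual H) (-u) j := by
  rintro y hy φ hφ hd ⟨δ, hδ, hmax⟩
  have := h y hy (-φ) hφ.neg hd.neg ⟨δ, hδ, fun x hx hxy => by
    have := hmax x hx hxy
    simp only [Pi.neg_apply] at this ⊢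
    linarith⟩
  rw [pd_neg] at this
  simpa [dual] using this

lemma EdgeSub.edgeSuper_dual {H : N.J → ℝ → ℝ → ℝ → ℝ} {u : N.J → ℝ → ℝ} {j : N.J}
    (h : N.EdgeSub H u j) : N.EdgeSuper (dual H) (-u) j := by
  rintro y hy φ hφ hd ⟨δ, hδ, hmin⟩
  have := h y hy (-φ) hφ.neg hd.neg ⟨δ, hδ, fun x hx hxy => by
    have := hmin x hx hxy
    simp only [Pi.neg_apply] at this ⊢
    linarith⟩
  rw [pd_neg] at this
  simpa [dual] using this

lemma VertexSuper.vertexSub_dual {H : N.J → ℝ → ℝ → ℝ → ℝ} {u : N.J → ℝ → ℝ} {i : N.I}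
    {j k : N.J} (h : N.VertexSuper H u i j k) : N.VertexSub (dual H) (-u) i j k := by
  rintro φ hφ ⟨δ, hδ, hj, hk⟩
  have := h (-φ) hφ.neg ⟨δ, hδ, fun x hx hxy => by
    have := hj x hx hxy
    simp only [Pi.neg_apply] at this ⊢
    linarith, fun x hx hxy => by
    have := hk x hx hxy
    simp only [Pi.neg_apply] at this ⊢
    linarith⟩
  rw [pd_neg] at this
  simpa [dual] using this

lemma VertexSub.vertexSuper_dual {H : N.J → ℝ → ℝ → ℝ → ℝ} {u : N.J → ℝ → ℝ} {i : N.I}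
    {j k : N.J} (h : N.VertexSub H u i j k) : N.VertexSuper (dual H) (-u) i j k := by
  rintro φ hφ ⟨δ, hδ, hj, hk⟩
  have := h (-φ) hφ.neg ⟨δ, hδ, fun x hx hxy => by
    have := hj x hx hxy
    simp only [Pi.neg_apply] at this ⊢
    linarith, fun x hx hxy => by
    have := hk x hx hxy
    simp only [Pi.neg_apply] at this ⊢
    linarith⟩
  rw [pd_neg] at this
  simpa [dual] using this

/-- A differentiable function touching `f` from above controls the growth of `f`. -/
lemma le_linear_of_localMax {f φ : ℝ → ℝ} {s : Set ℝ} {y : ℝ}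
    (hφ : DifferentiableWithinAt ℝ φ s y) {δ : ℝ} (hδ : 0 < δ)
    (hmax : ∀ x ∈ s, |x - y| < δ → f x - φ x ≤ f y - φ y) {ε : ℝ} (hε : 0 < ε) :
    ∃ δ' > 0, ∀ x ∈ s, |x - y| < δ' →
      f x ≤ f y + derivWithin φ s y * (x - y) + ε * |x - y| := by
  have h := hφ.hasDerivWithinAt.isLittleO.def hε
  rw [Filter.Eventually, Metric.mem_nhdsWithin_iff] at h
  obtain ⟨r, hr, h⟩ := h
  refine ⟨min r δ, lt_min hr hδ, fun x hx hxy => ?_⟩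
  have h1 : x ∈ {x | ‖φ x - φ y - (x - y) • derivWithin φ s y‖ ≤ ε * ‖x - y‖} :=
    h ⟨by simpa [Real.dist_eq] using hxy.trans_le (min_le_left _ _), hx⟩
  have h2 := le_of_abs_le (by simpa only [Real.norm_eq_abs, mem_ofPred_eq] using h1)
  have h3 := hmax x hx (hxy.trans_le (min_le_right _ _))
  simp only [smul_eq_mul] at h2
  linarith

/-- Positivity of `H` at a point is inherited locally by the approximations `Hn`. -/
def PosStable (N : Network) (Hn : ℕ → N.J → ℝ → ℝ → ℝ → ℝ) (H : N.J → ℝ → ℝ → ℝ → ℝ) : Prop :=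
  ∀ j, ∀ y ∈ N.edge j, ∀ r p, 0 < H j y r p → ∃ η > 0, ∀ᶠ n in atTop, ∀ x ∈ N.edge j,
    |x - y| < η → ∀ r', |r' - r| < η → ∀ p', |p' - p| < η → 0 < Hn n j x r' p'

/-- If `v - φ` has a local maximum at `y` and `H > 0` there, then for large `n` the function
`u n` is touched at `y` itself by a quadratic with the same slope. -/
lemma eventually_localMax_cutoffQuadratic {Hn : ℕ → N.J → ℝ → ℝ → ℝ → ℝ}
    {H : N.J → ℝ → ℝ → ℝ → ℝ} (hH : N.PosStable Hn H) {u : ℕ → N.J → ℝ → ℝ}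
    {v : N.J → ℝ → ℝ} {j : N.J} (hu : ∀ n, ContinuousOn (u n j) (N.edge j))
    (hv : ContinuousOn (v j) (N.edge j))
    (huv : TendstoUniformlyOn (fun n => u n j) (v j) atTop (N.edge j))
    {y : ℝ} (hy : y ∈ N.edge j) {φ : ℝ → ℝ} (hφ : DifferentiableWithinAt ℝ φ (N.edge j) y)
    {δ₀ : ℝ} (hδ₀ : 0 < δ₀)
    (hmax : ∀ x ∈ N.edge j, |x - y| < δ₀ → v j x - φ x ≤ v j y - φ y)
    (hpos : 0 < H j y (v j y) (derivWithin φ (N.edge j) y)) :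
    ∃ c, ∃ δ > 0,
      cutoffQuadratic (derivWithin φ (N.edge j) y) c δ y 0 = 0 ∧
      cutoffQuadratic (derivWithin φ (N.edge j) y) c δ y (N.l j) = 0 ∧
      ∀ᶠ n in atTop, N.EdgeSub (Hn n) (u n) j →
        (∀ x ∈ N.edge j, |x - y| < δ →
          u n j x - cutoffQuadratic (derivWithin φ (N.edge j) y) c δ y x ≤
          u n j y - cutoffQuadratic (derivWithin φ (N.edge j) y) c δ y y) ∧
        0 < Hn n j y (u n j y) (derivWithin φ (N.edge j) y) := by
  set p := derivWithin φ (N.edge j) y with hp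
  obtain ⟨η, hη, hHn⟩ := hH j y hy _ p hpos
  obtain ⟨δ₁, hδ₁, hlin⟩ := le_linear_of_localMax hφ hδ₀ hmax (show 0 < η / 8 by positivity)
  obtain ⟨δ₂, hδ₂, hvc⟩ := Metric.continuousOn_iff.1 hv y hy (η / 2) (by positivity)
  have hsep : ∀ e : ℝ, ∃ ρ > 0, e = y ∨ 2 * ρ ≤ |e - y| := by
    intro e
    by_cases he : e = y
    · exact ⟨1, one_pos, Or.inl he⟩
    · exact ⟨|e - y| / 2, half_pos (abs_pos.2 (sub_ne_zero.2 he)), Or.inr (by linarith)⟩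
  obtain ⟨ρ₀, hρ₀, h0⟩ := hsep 0
  obtain ⟨ρ₁, hρ₁, h1⟩ := hsep (N.l j)
  obtain ⟨δ, hδ, hδlt⟩ : ∃ δ > 0, δ < min (min δ₁ δ₂) (min (min ρ₀ ρ₁) η) :=
    exists_between (by simp [*])
  simp only [lt_min_iff] at hδlt
  obtain ⟨⟨hd1, hd2⟩, ⟨hd3, hd4⟩, hd5⟩ := hδlt
  have h0' : (0 : ℝ) = y ∨ 2 * δ ≤ |0 - y| := h0.imp_right (by intro; linarith)
  have h1' : N.l j = y ∨ 2 * δ ≤ |N.l j - y| := h1.imp_right (by intro; linarith)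
  have hends : ∀ c e : ℝ, e = y ∨ 2 * δ ≤ |e - y| → cutoffQuadratic p c δ y e = 0 := by
    rintro c e (rfl | he)
    · simp
    · exact cutoffQuadratic_of_le_abs hδ he
  set c := η / 4 / δ with hc
  have hcδ : c * δ = η / 4 := by rw [hc]; field_simp
  refine ⟨c, δ, hδ, hends c 0 h0', hends c _ h1', ?_⟩
  have hτ : 0 < min (η / 2) (η / 8 * δ / 2) := by positivity
  filter_upwards [hHn, Metric.tendstoUniformlyOn_iff.1 huv _ hτ] with n hHn hun hsub
  have hun1 : ∀ x ∈ N.edge j, |v j x - u n j x| < η / 2 := fun x hx =>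
    (hun x hx).trans_le (min_le_left _ _)
  have hun2 : ∀ x ∈ N.edge j, |v j x - u n j x| < η / 8 * δ / 2 := fun x hx =>
    (hun x hx).trans_le (min_le_right _ _)
  have hclose : ∀ x ∈ N.edge j, |x - y| < δ → |u n j x - v j y| < η := by
    intro x hx hxy
    have a := hun1 x hx
    have b : |v j x - v j y| < η / 2 := hvc x hx (by rw [Real.dist_eq]; linarith)
    rw [abs_lt] at *
    constructor <;> linarith [a.1, a.2, b.1, b.2]
  refine ⟨?_, hHn y hy (by simpa) _ (hclose y hy (by simpa)) _ (by simpa)⟩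
  set g := cutoffQuadratic p c δ y with hg
  have hKc : IsCompact (N.edge j ∩ Metric.closedBall y δ) :=
    isCompact_Icc.inter_right Metric.isClosed_closedBall
  obtain ⟨z, ⟨hz, hzy⟩, hzmax⟩ := hKc.exists_isMaxOn (f := fun x => u n j x - g x)
    ⟨y, hy, Metric.mem_closedBall_self hδ.le⟩
    (((hu n).sub (continuous_cutoffQuadratic p c δ y).continuousOn).mono inter_subset_left)
  replace hzmax : ∀ x ∈ N.edge j, |x - y| ≤ δ → u n j x - g x ≤ u n j z - g z :=
    fun x hx hxy => hzmax ⟨hx, by simpa [Real.dist_eq] using hxy⟩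
  rw [Metric.mem_closedBall, Real.dist_eq] at hzy
  have hzlt : |z - y| < δ := by
    refine lt_of_le_of_ne hzy fun hzd => ?_
    have a := hzmax y hy (by simpa using hδ.le)
    rw [hg, cutoffQuadratic_self, cutoffQuadratic_of_abs_le hδ hzy] at a
    have b := hlin z hz (by linarith)
    have e1 := abs_lt.1 (hun2 z hz)
    have e2 := abs_lt.1 (hun2 y hy)
    have e3 : c * (z - y) ^ 2 = η / 4 * δ := by
      rw [← sq_abs, hzd, ← hcδ]; ring
    rw [hzd] at b
    have e4 : 0 < η * δ := by positivity
    nlinarith [e1.1, e1.2, e2.1, e2.2]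
  have hzeq : z = y := by
    by_contra hne
    have hz0 : (0 : ℝ) ≠ z := by
      rintro rfl
      rcases h0' with h | h
      · exact hne h
      · linarith
    have hzl : z ≠ N.l j := by
      rintro h'
      rw [← h'] at h1'
      rcases h1' with h | h
      · exact hne h
      · linarith
    obtain ⟨ψ, hψ, hψj, -⟩ := N.exists_isCont_extension j j
      (continuous_cutoffQuadratic p c δ y) (continuous_cutoffQuadratic p c δ y)
      (hends c 0 h0') (hends c _ h1') (hends c 0 h0') (hends c _ h1')
    have hder : HasDerivWithinAt (ψ j) (p + 2 * c * (z - y)) (N.edge j) z := by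
      rw [hψj]
      exact (hasDerivAt_cutoffQuadratic hδ hzlt).hasDerivWithinAt
    have hle := hsub z ⟨lt_of_le_of_ne hz.1 hz0, lt_of_le_of_ne hz.2 hzl⟩ ψ hψ
      hder.differentiableWithinAt ⟨δ - |z - y|, by linarith, fun x hx hxz => by
        rw [hψj]
        refine hzmax x hx ?_
        have := abs_sub_le x z y
        linarith⟩
    rw [pd, hder.derivWithin (N.uniqueDiffWithinAt_edge hz)] at hle
    refine hle.not_gt (hHn z hz (by linarith) _ (hclose z hz hzlt) _ ?_)
    have hc0 : 0 < c := by positivity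
    rw [add_sub_cancel_left, abs_mul, abs_of_pos (by positivity)]
    nlinarith
  subst hzeq
  exact fun x hx hxy => hzmax x hx hxy.le

lemma EdgeSub.of_tendsto {Hn : ℕ → N.J → ℝ → ℝ → ℝ → ℝ}
    {H : N.J → ℝ → ℝ → ℝ → ℝ} (hH : N.PosStable Hn H) {u : ℕ → N.J → ℝ → ℝ}
    {v : N.J → ℝ → ℝ} {j : N.J} (hu : ∀ n, ContinuousOn (u n j) (N.edge j))
    (hv : ContinuousOn (v j) (N.edge j))
    (huv : TendstoUniformlyOn (fun n => u n j) (v j) atTop (N.edge j))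
    (hsub : ∀ n, N.EdgeSub (Hn n) (u n) j) : N.EdgeSub H v j := by
  rintro y hy φ - hd ⟨δ₀, hδ₀, hmax⟩
  by_contra! hpos
  have hy' : y ∈ N.edge j := Ioo_subset_Icc_self hy
  obtain ⟨c, δ, hδ, h0, hl, h⟩ :=
    eventually_localMax_cutoffQuadratic hH hu hv huv hy' hd hδ₀ hmax hpos
  obtain ⟨n, hn⟩ := h.exists
  obtain ⟨hm, hp⟩ := hn (hsub n)
  obtain ⟨ψ, hψ, hψj, -⟩ := N.exists_isCont_extension j j
    (continuous_cutoffQuadratic _ c δ y) (continuous_cutoffQuadratic _ c δ y) h0 hl h0 hl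
  have hder : HasDerivWithinAt (ψ j) (derivWithin (φ j) (N.edge j) y) (N.edge j) y := by
    rw [hψj]
    exact (hasDerivAt_cutoffQuadratic_self hδ).hasDerivWithinAt
  have hle := hsub n y hy ψ hψ hder.differentiableWithinAt ⟨δ, hδ, by rwa [hψj]⟩
  rw [pd, hder.derivWithin (N.uniqueDiffWithinAt_edge hy')] at hle
  exact hle.not_gt hp

lemma VertexSub.of_tendsto {Hn : ℕ → N.J → ℝ → ℝ → ℝ → ℝ}
    {H : N.J → ℝ → ℝ → ℝ → ℝ} (hH : N.PosStable Hn H) {u : ℕ → N.J → ℝ → ℝ}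
    {v : N.J → ℝ → ℝ} {i : N.I} {j k : N.J} (hjk : j ≠ k)
    (hsymm : ∀ r p q, |p| = |q| → H j (N.param i j) r p = H k (N.param i k) r q)
    (hu : ∀ n m, ContinuousOn (u n m) (N.edge m))
    (hv : ∀ m, ContinuousOn (v m) (N.edge m))
    (hvi : v j (N.param i j) = v k (N.param i k))
    (huv : ∀ m, TendstoUniformlyOn (fun n => u n m) (v m) atTop (N.edge m))
    (hsub : ∀ n m, N.EdgeSub (Hn n) (u n) m)
    (hvertex : ∃ᶠ n in atTop, N.VertexSub (Hn n) (u n) i j k) : N.VertexSub H v i j k := by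
  rintro φ ⟨-, hdj, hdk, hsum⟩ ⟨δ₀, hδ₀, hmaxj, hmaxk⟩
  by_contra! hpos
  have hyj := N.param_mem_edge i j
  have hyk := N.param_mem_edge i k
  have hposk : 0 < H k (N.param i k) (v k (N.param i k)) (N.pd φ k (N.param i k)) := by
    rw [← hvi, ← hsymm _ (N.pd φ j (N.param i j))]
    · exact hpos
    · have := congrArg abs (eq_neg_of_add_eq_zero_left hsum)
      simpa [abs_mul, abs_sgn] using this
  obtain ⟨c, δ, hδ, h0, hl, h⟩ := eventually_localMax_cutoffQuadratic hH (fun n => hu n j) (hv j)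
    (huv j) hyj hdj hδ₀ hmaxj hpos
  obtain ⟨c', δ', hδ', h0', hl', h'⟩ := eventually_localMax_cutoffQuadratic hH (fun n => hu n k)
    (hv k) (huv k) hyk hdk hδ₀ hmaxk hposk
  obtain ⟨n, hn, hnj, hnk⟩ := (hvertex.and_eventually (h.and h')).exists
  obtain ⟨hm, hp⟩ := hnj (hsub n j)
  obtain ⟨hm', -⟩ := hnk (hsub n k)
  obtain ⟨ψ, hψ, hψj, hψk⟩ := N.exists_isCont_extension j k
    (continuous_cutoffQuadratic _ c δ _) (continuous_cutoffQuadratic _ c' δ' _) h0 hl h0' hl'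
  replace hψk := hψk hjk
  have hder : HasDerivWithinAt (ψ j) (N.pd φ j (N.param i j)) (N.edge j) (N.param i j) := by
    rw [hψj]
    exact (hasDerivAt_cutoffQuadratic_self hδ).hasDerivWithinAt
  have hder' : HasDerivWithinAt (ψ k) (N.pd φ k (N.param i k)) (N.edge k) (N.param i k) := by
    rw [hψk]
    exact (hasDerivAt_cutoffQuadratic_self hδ').hasDerivWithinAt
  have hpj : N.pd ψ j (N.param i j) = N.pd φ j (N.param i j) :=
    hder.derivWithin (N.uniqueDiffWithinAt_edge hyj)
  have hpk : N.pd ψ k (N.param i k) = N.pd φ k (N.param i k) :=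
    hder'.derivWithin (N.uniqueDiffWithinAt_edge hyk)
  have hle := hn ψ
    ⟨hψ, hder.differentiableWithinAt, hder'.differentiableWithinAt, by rwa [hpj, hpk]⟩
    ⟨min δ δ', lt_min hδ hδ', fun x hx hxy => by
      simp only [hψj]
      exact hm x hx (hxy.trans_le (min_le_left _ _)), fun x hx hxy => by
      simp only [hψk]
      exact hm' x hx (hxy.trans_le (min_le_right _ _))⟩
  rw [hpj] at hle
  exact hle.not_gt hp

/-- Locally uniform convergence to a continuous limit preserves positivity locally. -/
lemma posStable_of_tendsto {Hn : ℕ → N.J → ℝ → ℝ → ℝ → ℝ} {H : N.J → ℝ → ℝ → ℝ → ℝ}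
    (hH : N.H0 H)
    (hconv : ∀ j, TendstoLocallyUniformlyOn
      (fun n (q : ℝ × ℝ × ℝ) => Hn n j q.1 q.2.1 q.2.2)
      (fun q : ℝ × ℝ × ℝ => H j q.1 q.2.1 q.2.2) atTop
      ((N.edge j) ×ˢ (univ : Set ℝ) ×ˢ (univ : Set ℝ))) :
    N.PosStable Hn H := by
  intro j y hy r p hpos
  have hmem : (y, r, p) ∈ N.edge j ×ˢ (univ : Set ℝ) ×ˢ (univ : Set ℝ) := by simp [hy]
  obtain ⟨t, ht, hn⟩ := Metric.tendstoLocallyUniformlyOn_iff.1 (hconv j) _ (half_pos hpos) _ hmem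
  have hc := (hH j _ hmem).eventually_const_lt (half_lt_self hpos)
  obtain ⟨η, hη, hsub⟩ := Metric.mem_nhdsWithin_iff.1 (inter_mem ht hc)
  refine ⟨η, hη, ?_⟩
  filter_upwards [hn] with n hn x hx hxy r' hr p' hp
  have hq := hsub (show (x, r', p') ∈ _ from
    ⟨by simp [Prod.dist_eq, Real.dist_eq, hxy, hr, hp], by simp [hx]⟩)
  have h1 := hn _ hq.1
  have h2 : H j y r p / 2 < H j x r' p' := hq.2
  rw [Real.dist_eq, abs_lt] at h1
  simp only at h1
  linarith [h1.2]

lemma H0.dual {H : N.J → ℝ → ℝ → ℝ → ℝ} (hH : N.H0 H) : N.H0 (dual H) := by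
  intro j
  refine ((hH j).comp (f := fun q : ℝ × ℝ × ℝ => (q.1, -q.2.1, -q.2.2)) (by fun_prop) ?_).neg
  intro q hq
  simpa using hq

lemma tendstoLocallyUniformlyOn_dual {Hn : ℕ → N.J → ℝ → ℝ → ℝ → ℝ}
    {H : N.J → ℝ → ℝ → ℝ → ℝ} {j : N.J}
    (hconv : TendstoLocallyUniformlyOn
      (fun n (q : ℝ × ℝ × ℝ) => Hn n j q.1 q.2.1 q.2.2)
      (fun q : ℝ × ℝ × ℝ => H j q.1 q.2.1 q.2.2) atTop
      ((N.edge j) ×ˢ (univ : Set ℝ) ×ˢ (univ : Set ℝ))) :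
    TendstoLocallyUniformlyOn
      (fun n (q : ℝ × ℝ × ℝ) => dual (Hn n) j q.1 q.2.1 q.2.2)
      (fun q : ℝ × ℝ × ℝ => dual H j q.1 q.2.1 q.2.2) atTop
      ((N.edge j) ×ˢ (univ : Set ℝ) ×ˢ (univ : Set ℝ)) :=
  (hconv.comp (fun q : ℝ × ℝ × ℝ => (q.1, -q.2.1, -q.2.2)) (fun q hq => by simpa using hq)
    (by fun_prop)).neg

lemma eq_of_abs_eq {H : N.J → ℝ → ℝ → ℝ → ℝ} (hH5 : N.H5 H) (hH6 : N.H6 H) {i : N.I}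
    (hi : i ∈ N.IT) {j k : N.J} (hj : j ∈ N.Inc i) (hk : k ∈ N.Inc i) (r : ℝ) {p q : ℝ}
    (hpq : |p| = |q|) : H j (N.param i j) r p = H k (N.param i k) r q := by
  rcases abs_eq_abs.1 hpq with rfl | rfl
  · exact hH5 i hi j hj k hk r p
  · rw [← hH6 i hi j hj]
    exact hH5 i hi j hj k hk r q

end Network

open Network in
/-- **Proposition 2.10** (stability of viscosity solutions under uniform convergence). -/
theorem viscosity_stability
    (N : Network) (Hn : ℕ → N.J → ℝ → ℝ → ℝ → ℝ) (H : N.J → ℝ → ℝ → ℝ → ℝ)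
    (hHn0 : ∀ n, N.H0 (Hn n)) (hHn1 : ∀ n, N.H1 (Hn n)) (hHn3 : ∀ n, N.H3 (Hn n))
    (hHn4 : ∀ n, N.H4 (Hn n)) (hHn5 : ∀ n, N.H5 (Hn n)) (hHn6 : ∀ n, N.H6 (Hn n))
    (hH0 : N.H0 H) (hH1 : N.H1 H) (hH3 : N.H3 H) (hH4 : N.H4 H)
    (hH5 : N.H5 H) (hH6 : N.H6 H)
    (u : ℕ → N.J → ℝ → ℝ)
    (hsol : ∀ n, N.IsViscSol (Hn n) (u n))
    (hHconv : ∀ j, TendstoLocallyUniformlyOn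
      (fun n (q : ℝ × ℝ × ℝ) => Hn n j q.1 q.2.1 q.2.2)
      (fun q : ℝ × ℝ × ℝ => H j q.1 q.2.1 q.2.2) Filter.atTop
      ((N.edge j) ×ˢ (Set.univ : Set ℝ) ×ˢ (Set.univ : Set ℝ)))
    (v : N.J → ℝ → ℝ)
    (hconv : ∀ j, TendstoUniformlyOn (fun n => u n j) (v j) Filter.atTop (N.edge j)) :
    N.IsViscSol H v := by
  have hu : ∀ n m, ContinuousOn (u n m) (N.edge m) := fun n => (hsol n).1.2
  have hv : ∀ m, ContinuousOn (v m) (N.edge m) := fun m =>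
    (hconv m).continuousOn (Filter.Frequently.of_forall fun n => hu n m)
  have hcompat : N.Compat v := fun i j hj k hk =>
    tendsto_nhds_unique ((hconv j).tendsto_at (N.param_mem_edge i j))
      (((hconv k).tendsto_at (N.param_mem_edge i k)).congr fun n =>
        ((hsol n).1.1 i j hj k hk).symm)
  have hpos := posStable_of_tendsto hH0 hHconv
  have hneg : N.PosStable (fun n => dual (Hn n)) (dual H) :=
    posStable_of_tendsto hH0.dual fun j => tendstoLocallyUniformlyOn_dual (hHconv j)
  have hconv' : ∀ m, TendstoUniformlyOn (fun n => (-u n) m) ((-v) m) Filter.atTop (N.edge m) :=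
    fun m => (hconv m).neg
  have hsub : ∀ n m, N.EdgeSub (Hn n) (u n) m := fun n => (hsol n).2.1.2.1
  have hsuper : ∀ n m, N.EdgeSub (dual (Hn n)) (-u n) m := fun n m =>
    EdgeSuper.edgeSub_dual ((hsol n).2.2.2.1 m)
  refine ⟨⟨hcompat, hv⟩, ⟨⟨hcompat, fun j => (hv j).upperSemicontinuousOn⟩, fun j => ?_, ?_⟩,
    ⟨hcompat, fun j => (hv j).lowerSemicontinuousOn⟩, fun j => ?_, ?_⟩
  · exact EdgeSub.of_tendsto hpos (fun n => hu n j) (hv j) (hconv j) fun n => hsub n j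
  · intro i hi j hj k hk hjk
    exact VertexSub.of_tendsto hpos hjk (fun r p q => eq_of_abs_eq hH5 hH6 hi hj hk r) hu hv
      (hcompat i j hj k hk) hconv hsub
      (Filter.Frequently.of_forall fun n => (hsol n).2.1.2.2 i hi j hj k hk hjk)
  · have h := (EdgeSub.of_tendsto hneg (fun n => (hu n j).neg) (hv j).neg (hconv' j)
      fun n => hsuper n j).edgeSuper_dual
    rwa [dual_dual, neg_neg] at h
  · intro i hi j hj
    choose κ hκ hκj hκsuper using fun n => (hsol n).2.2.2.2 i hi j hj
    obtain ⟨k, hk⟩ : ∃ k, ∃ᶠ n in Filter.atTop, κ n = k := by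
      rw [← Filter.frequently_exists]
      exact Filter.Frequently.of_forall fun n => ⟨κ n, rfl⟩
    obtain ⟨n₀, rfl⟩ := hk.exists
    have h := (VertexSub.of_tendsto (u := fun n => -u n) (v := -v) (i := i) hneg (hκj n₀).symm
      (fun r p q hpq => congrArg Neg.neg
        (eq_of_abs_eq hH5 hH6 hi hj (hκ n₀) (-r) (by simpa using hpq)))
      (fun n m => (hu n m).neg) (fun m => (hv m).neg)
      (congrArg Neg.neg (hcompat i j hj _ (hκ n₀))) hconv' hsuper
      (hk.mono fun n hn => by
        rw [← hn]
        exact VertexSuper.vertexSub_dual (hκsuper n))).vertexSuper_dual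
    rw [dual_dual, neg_neg] at h
    exact ⟨κ n₀, hκ n₀, hκj n₀, h⟩
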